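/- Let k be a commutative ring, V a k-module, and R : V⊗V → V⊗V a linear map satisfying the Yang–Baxter equation. For m ≥ 2 and 1 ≤ i ≤ m−1 let σ_{m,i} = 1^{⊗(i−1)}⊗R⊗1^{⊗(m−i−1)} : V^{⊗m} → V^{⊗m}. For n ≥ q ≥ 2 and φ : V^{⊗n} → V^{⊗q}, define d₂(φ) = (−1)^n Σ_{i=1}^{q}(−1)^i [σ_{q+1,i−1}···σ_{q+1,1}(1⊗φ)σ_{n+1,1}···σ_{n+1,n−i+1} − σ_{q+1,i}···σ_{q+1,q}(φ⊗1)σ_{n+1,n}···σ_{n+1,n−i+2}], where empty products of σ's are identity maps, so that d₂(φ) : V^{⊗(n+1)} → V^{⊗(q+1)}. Then d₂ ∘ d₂ = 0: for every φ : V^{⊗n} → V^{⊗q} with n > q ≥ 2, d₂(d₂(φ)) = 0. -/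

import Mathlib

open TensorProduct LinearMap

noncomputable section

universe u v

variable (k : Type u) [CommRing k] (V : Type v) [AddCommGroup V] [Module k V]

/-- The tower of tensor powers of `V`: `TPobj n` is `V^{⊗(n+1)}`,
associated to the left. -/
def TPobj : ℕ → ModuleCat.{v} k
  | 0 => ModuleCat.of k V
  | n + 1 => ModuleCat.of k ((TPobj n) ⊗[k] V)

/-- `TP k V n` is the `(n+1)`-st tensor power `V^{⊗(n+1)}` of `V`. -/
abbrev TP (n : ℕ) : Type v := (TPobj k V n : Type v)

variable {k V}

/-- `σ_{n+1,i}`: a braiding `R` acting on the `i`-th and `(i+1)`-st tensor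
factors of `TP k V n = V^{⊗(n+1)}` (the identity if `i` is out of range). -/
def sigmaMap (R : V ⊗[k] V →ₗ[k] V ⊗[k] V) :
    (n : ℕ) → ℕ → (TP k V n →ₗ[k] TP k V n)
  | 0, _ => LinearMap.id
  | 1, i => if i = 1 then (R : TP k V 1 →ₗ[k] TP k V 1) else LinearMap.id
  | (m + 2), i =>
    if i = m + 2 then
      (TensorProduct.assoc k (TP k V m) V V).symm.toLinearMap ∘ₗ
        R.lTensor (TP k V m) ∘ₗ (TensorProduct.assoc k (TP k V m) V V).toLinearMap
    else (sigmaMap R (m + 1) i).rTensor V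

/-- Composition `σ_{n+1,l₁} ∘ σ_{n+1,l₂} ∘ ⋯` over a list of indices. -/
def sigmaComp (R : V ⊗[k] V →ₗ[k] V ⊗[k] V) (n : ℕ) (l : List ℕ) :
    TP k V n →ₗ[k] TP k V n :=
  l.foldr (fun i acc => sigmaMap R n i ∘ₗ acc) LinearMap.id

/-- The canonical isomorphism `V ⊗ V^{⊗(n+1)} ≅ V^{⊗(n+2)}` prepending a
tensor factor on the left. -/
def lcons : (n : ℕ) → (V ⊗[k] TP k V n ≃ₗ[k] TP k V (n + 1))
  | 0 => LinearEquiv.refl k (V ⊗[k] V)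
  | n + 1 =>
    (TensorProduct.assoc k V (TP k V n) V).symm ≪≫ₗ
      TensorProduct.congr (lcons n) (LinearEquiv.refl k V)

/-- `1 ⊗ φ : V^{⊗(p+2)} → V^{⊗(q+2)}` for `φ : V^{⊗(p+1)} → V^{⊗(q+1)}`. -/
def oneTensor {p q : ℕ} (φ : TP k V p →ₗ[k] TP k V q) :
    TP k V (p + 1) →ₗ[k] TP k V (q + 1) :=
  (lcons q).toLinearMap ∘ₗ φ.lTensor V ∘ₗ (lcons p).symm.toLinearMap

/-- `φ ⊗ 1 : V^{⊗(p+2)} → V^{⊗(q+2)}` for `φ : V^{⊗(p+1)} → V^{⊗(q+1)}`. -/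
def tensorOne {p q : ℕ} (φ : TP k V p →ₗ[k] TP k V q) :
    TP k V (p + 1) →ₗ[k] TP k V (q + 1) :=
  φ.rTensor V


/-- The bidegree `(2,−1)` differential `d₂` of the Yang-Baxter Hochschild
multicomplex, for a cochain `φ : V^{⊗n} → V^{⊗q}` (here `n = a + 1`,
`q = b + 1`):
`d₂(φ) = (−1)^n Σ_{i=1}^{q} (−1)^i
  [σ_{q+1,i−1}⋯σ_{q+1,1}(1⊗φ)σ_{n+1,1}⋯σ_{n+1,n−i+1}
   − σ_{q+1,i}⋯σ_{q+1,q}(φ⊗1)σ_{n+1,n}⋯σ_{n+1,n−i+2}]`. -/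
def d2M (R : V ⊗[k] V →ₗ[k] V ⊗[k] V) (a b : ℕ)
    (φ : TP k V a →ₗ[k] TP k V b) : TP k V (a + 1) →ₗ[k] TP k V (b + 1) :=
  ∑ j ∈ Finset.range (b + 1), ((-1 : ℤ) ^ (a + j)) •
    (sigmaComp R (b + 1) ((List.range' 1 j).reverse) ∘ₗ oneTensor φ ∘ₗ
        sigmaComp R (a + 1) (List.range' 1 ((a + 2) - (j + 1)))
      - sigmaComp R (b + 1) (List.range' (j + 1) ((b + 2) - (j + 1))) ∘ₗ
        tensorOne φ ∘ₗ
        sigmaComp R (a + 1) ((List.range' (((a + 2) - (j + 1)) + 1) j).reverse))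

/-- The identification `V^{⊗(n+1)} ⊗ V = V^{⊗(n+2)}` appending a tensor factor on the right. -/
def rcons (n : ℕ) : TP k V n ⊗[k] V ≃ₗ[k] TP k V (n + 1) :=
  LinearEquiv.refl k (TP k V n ⊗[k] V)

/-- `x ⊗ (u ⊗ v) ↦ (x ⊗ u) ⊗ v`, appending two tensor factors on the right. -/
def rconsTwo (n : ℕ) : TP k V n ⊗[k] (V ⊗[k] V) ≃ₗ[k] TP k V (n + 2) :=
  (TensorProduct.assoc k (TP k V n) V V).symm

/-- `(u ⊗ v) ⊗ x ↦ u ⊗ (v ⊗ x)`, prepending two tensor factors on the left. -/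
def lconsTwo (n : ℕ) : (V ⊗[k] V) ⊗[k] TP k V n ≃ₗ[k] TP k V (n + 2) :=
  TensorProduct.assoc k V V (TP k V n) ≪≫ₗ
    TensorProduct.congr (LinearEquiv.refl k V) (lcons n) ≪≫ₗ lcons (n + 1)

/-- Linear maps agreeing on the pure tensors of a tensor product isomorphic to their source
are equal. -/
lemma TensorProduct.hom_ext_equiv {A B C M : Type*} [AddCommGroup A] [Module k A]
    [AddCommGroup B] [Module k B] [AddCommGroup C] [Module k C] [AddCommGroup M] [Module k M]
    (e : A ⊗[k] B ≃ₗ[k] C) {f g : C →ₗ[k] M}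
    (h : ∀ x y, f (e (x ⊗ₜ[k] y)) = g (e (x ⊗ₜ[k] y))) : f = g := by
  have : f ∘ₗ e.toLinearMap = g ∘ₗ e.toLinearMap := TensorProduct.ext' h
  ext z
  simpa using LinearMap.congr_fun this (e.symm z)

lemma rconsTwo_tmul (n : ℕ) (x : TP k V n) (u v : V) :
    rconsTwo n (x ⊗ₜ[k] (u ⊗ₜ[k] v)) = rcons (n + 1) (rcons n (x ⊗ₜ[k] u) ⊗ₜ[k] v) :=
  rfl

lemma lconsTwo_tmul (n : ℕ) (u v : V) (x : TP k V n) :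
    lconsTwo n ((u ⊗ₜ[k] v) ⊗ₜ[k] x) = lcons (n + 1) (u ⊗ₜ[k] lcons n (v ⊗ₜ[k] x)) :=
  rfl

lemma lcons_rcons (n : ℕ) (v : V) (x : TP k V n) (w : V) :
    lcons (n + 1) (v ⊗ₜ[k] rcons n (x ⊗ₜ[k] w)) =
      rcons (n + 1) (lcons n (v ⊗ₜ[k] x) ⊗ₜ[k] w) :=
  rfl

lemma lcons_rconsTwo (n : ℕ) (v : V) (x : TP k V n) (t : V ⊗[k] V) :
    lcons (n + 2) (v ⊗ₜ[k] rconsTwo n (x ⊗ₜ[k] t)) =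
      rconsTwo (n + 1) (lcons n (v ⊗ₜ[k] x) ⊗ₜ[k] t) := by
  induction t using TensorProduct.induction_on with
  | zero => simp
  | add t u ht hu => simp only [TensorProduct.tmul_add, map_add, ht, hu]
  | tmul u w => simp only [rconsTwo_tmul, lcons_rcons]

lemma lconsTwo_rcons (n : ℕ) (t : V ⊗[k] V) (x : TP k V n) (w : V) :
    lconsTwo (n + 1) (t ⊗ₜ[k] rcons n (x ⊗ₜ[k] w)) =
      rcons (n + 2) (lconsTwo n (t ⊗ₜ[k] x) ⊗ₜ[k] w) := by
  induction t using TensorProduct.induction_on with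
  | zero => simp
  | add t u ht hu => simp only [TensorProduct.add_tmul, map_add, ht, hu]
  | tmul u v => simp only [lconsTwo_tmul, lcons_rcons]

lemma oneTensor_lcons {p q : ℕ} (φ : TP k V p →ₗ[k] TP k V q) (v : V) (x : TP k V p) :
    oneTensor φ (lcons p (v ⊗ₜ[k] x)) = lcons q (v ⊗ₜ[k] φ x) := by
  simp [oneTensor]

lemma tensorOne_rcons {p q : ℕ} (φ : TP k V p →ₗ[k] TP k V q) (x : TP k V p) (v : V) :
    tensorOne φ (rcons p (x ⊗ₜ[k] v)) = rcons q (φ x ⊗ₜ[k] v) :=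
  rfl

lemma tensorOne_tensorOne_rconsTwo {p q : ℕ} (φ : TP k V p →ₗ[k] TP k V q) (x : TP k V p)
    (t : V ⊗[k] V) :
    tensorOne (tensorOne φ) (rconsTwo p (x ⊗ₜ[k] t)) = rconsTwo q (φ x ⊗ₜ[k] t) := by
  induction t using TensorProduct.induction_on with
  | zero => simp
  | add t u ht hu => simp only [TensorProduct.tmul_add, map_add, ht, hu]
  | tmul u v => simp only [rconsTwo_tmul, tensorOne_rcons]

lemma oneTensor_oneTensor_lconsTwo {p q : ℕ} (φ : TP k V p →ₗ[k] TP k V q) (t : V ⊗[k] V)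
    (x : TP k V p) :
    oneTensor (oneTensor φ) (lconsTwo p (t ⊗ₜ[k] x)) = lconsTwo q (t ⊗ₜ[k] φ x) := by
  induction t using TensorProduct.induction_on with
  | zero => simp
  | add t u ht hu => simp only [TensorProduct.add_tmul, map_add, ht, hu]
  | tmul u v => simp only [lconsTwo_tmul, oneTensor_lcons]

lemma oneTensor_comp {p q r : ℕ} (ψ : TP k V q →ₗ[k] TP k V r) (φ : TP k V p →ₗ[k] TP k V q) :
    oneTensor (ψ ∘ₗ φ) = oneTensor ψ ∘ₗ oneTensor φ :=
  TensorProduct.hom_ext_equiv (lcons p) fun v x ↦ by simp [oneTensor_lcons]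

lemma tensorOne_comp {p q r : ℕ} (ψ : TP k V q →ₗ[k] TP k V r) (φ : TP k V p →ₗ[k] TP k V q) :
    tensorOne (ψ ∘ₗ φ) = tensorOne ψ ∘ₗ tensorOne φ :=
  TensorProduct.hom_ext_equiv (rcons p) fun v x ↦ by simp [tensorOne_rcons]

lemma oneTensor_add {p q : ℕ} (φ ψ : TP k V p →ₗ[k] TP k V q) :
    oneTensor (φ + ψ) = oneTensor φ + oneTensor ψ :=
  TensorProduct.hom_ext_equiv (lcons p) fun v x ↦ by
    simp [oneTensor_lcons, TensorProduct.tmul_add]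

lemma tensorOne_add {p q : ℕ} (φ ψ : TP k V p →ₗ[k] TP k V q) :
    tensorOne (φ + ψ) = tensorOne φ + tensorOne ψ :=
  TensorProduct.hom_ext_equiv (rcons p) fun x v ↦ by
    simp [tensorOne_rcons, TensorProduct.add_tmul]

lemma oneTensor_id (n : ℕ) :
    oneTensor (LinearMap.id : TP k V n →ₗ[k] TP k V n) = LinearMap.id :=
  TensorProduct.hom_ext_equiv (lcons n) fun v x ↦ by simp [oneTensor_lcons]

lemma tensorOne_id (n : ℕ) :
    tensorOne (LinearMap.id : TP k V n →ₗ[k] TP k V n) = LinearMap.id :=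
  TensorProduct.hom_ext_equiv (rcons n) fun v x ↦ by simp [tensorOne_rcons]

lemma oneTensor_tensorOne {p q : ℕ} (φ : TP k V p →ₗ[k] TP k V q) :
    oneTensor (tensorOne φ) = tensorOne (oneTensor φ) := by
  refine TensorProduct.hom_ext_equiv (lcons (p + 1)) fun v z ↦ ?_
  obtain ⟨z, rfl⟩ := (rcons p).surjective z
  induction z using TensorProduct.induction_on with
  | zero => simp
  | add x y hx hy => simp only [TensorProduct.tmul_add, map_add, hx, hy]
  | tmul x w => rw [oneTensor_lcons, tensorOne_rcons, lcons_rcons, lcons_rcons, tensorOne_rcons,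
      oneTensor_lcons]

lemma tensorOne_sigmaMap (R : V ⊗[k] V →ₗ[k] V ⊗[k] V) {n i : ℕ} (hi : i ≤ n) :
    tensorOne (sigmaMap R n i) = sigmaMap R (n + 1) i := by
  cases n with
  | zero =>
    obtain rfl : i = 0 := by lia
    exact tensorOne_id 0
  | succ m => exact (if_neg (show i ≠ m + 2 by lia)).symm

lemma sigmaMap_top_rconsTwo (R : V ⊗[k] V →ₗ[k] V ⊗[k] V) (n : ℕ) (x : TP k V n)
    (t : V ⊗[k] V) :
    sigmaMap R (n + 2) (n + 2) (rconsTwo n (x ⊗ₜ[k] t)) = rconsTwo n (x ⊗ₜ[k] R t) := by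
  have h : sigmaMap R (n + 2) (n + 2) =
      (rconsTwo n).toLinearMap ∘ₗ R.lTensor (TP k V n) ∘ₗ (rconsTwo n).symm.toLinearMap :=
    if_pos rfl
  simp [h]

lemma lcons_one (z : V ⊗[k] TP k V 1) : lcons 1 z = rconsTwo 0 z := by
  change TensorProduct.congr (LinearEquiv.refl k (V ⊗[k] V)) (LinearEquiv.refl k V)
    ((TensorProduct.assoc k V V V).symm z) = (TensorProduct.assoc k V V V).symm z
  rw [TensorProduct.congr_refl_refl]
  rfl

lemma lconsTwo_zero (z : (V ⊗[k] V) ⊗[k] TP k V 0) : lconsTwo 0 z = rcons 1 z := by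
  change lcons 1 (TensorProduct.congr (LinearEquiv.refl k V) (LinearEquiv.refl k (V ⊗[k] V))
    (TensorProduct.assoc k V V V z)) = z
  rw [TensorProduct.congr_refl_refl]
  exact (lcons_one _).trans ((TensorProduct.assoc k V V V).symm_apply_apply z)

lemma oneTensor_sigmaMap (R : V ⊗[k] V →ₗ[k] V ⊗[k] V) {n i : ℕ} (hi : 1 ≤ i) (hin : i ≤ n) :
    oneTensor (sigmaMap R n i) = sigmaMap R (n + 1) (i + 1) := by
  induction n with
  | zero => lia
  | succ m ih =>
    rcases hin.lt_or_eq with hlt | rfl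
    · rw [← tensorOne_sigmaMap R (Nat.le_of_lt_succ hlt), oneTensor_tensorOne,
        ih (Nat.le_of_lt_succ hlt), tensorOne_sigmaMap R hlt]
    · cases m with
      | zero =>
        refine TensorProduct.hom_ext_equiv (lcons 1) fun v t ↦ ?_
        rw [oneTensor_lcons, lcons_one, lcons_one]
        exact (sigmaMap_top_rconsTwo R 0 v t).symm
      | succ m =>
        refine TensorProduct.hom_ext_equiv (lcons (m + 2)) fun v z ↦ ?_
        obtain ⟨z, rfl⟩ := (rconsTwo m).surjective z
        induction z using TensorProduct.induction_on with
        | zero => simp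
        | add x y hx hy => simp only [TensorProduct.tmul_add, map_add, hx, hy]
        | tmul x t =>
          rw [oneTensor_lcons, lcons_rconsTwo, sigmaMap_top_rconsTwo, lcons_rconsTwo]
          exact (sigmaMap_top_rconsTwo R (m + 1) _ t).symm

lemma tensorOne_tensorOne_comp_sigmaMap_top (R : V ⊗[k] V →ₗ[k] V ⊗[k] V) {p q : ℕ}
    (φ : TP k V p →ₗ[k] TP k V q) :
    tensorOne (tensorOne φ) ∘ₗ sigmaMap R (p + 2) (p + 2) =
      sigmaMap R (q + 2) (q + 2) ∘ₗ tensorOne (tensorOne φ) :=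
  TensorProduct.hom_ext_equiv (rconsTwo p) fun x t ↦ by
    simp only [LinearMap.comp_apply, sigmaMap_top_rconsTwo, tensorOne_tensorOne_rconsTwo]

lemma sigmaMap_one_lconsTwo (R : V ⊗[k] V →ₗ[k] V ⊗[k] V) (n : ℕ) (t : V ⊗[k] V)
    (x : TP k V n) :
    sigmaMap R (n + 2) 1 (lconsTwo n (t ⊗ₜ[k] x)) = lconsTwo n (R t ⊗ₜ[k] x) := by
  induction n with
  | zero =>
    rw [lconsTwo_zero, lconsTwo_zero]
    rfl
  | succ n ih =>
    rw [← tensorOne_sigmaMap R (show 1 ≤ n + 2 by lia)]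
    obtain ⟨x, rfl⟩ := (rcons n).surjective x
    induction x using TensorProduct.induction_on with
    | zero => simp
    | add x y hx hy => simp only [TensorProduct.tmul_add, map_add, hx, hy]
    | tmul x w => rw [lconsTwo_rcons, lconsTwo_rcons, tensorOne_rcons, ih]

lemma oneTensor_oneTensor_comp_sigmaMap_one (R : V ⊗[k] V →ₗ[k] V ⊗[k] V) {p q : ℕ}
    (φ : TP k V p →ₗ[k] TP k V q) :
    oneTensor (oneTensor φ) ∘ₗ sigmaMap R (p + 2) 1 =
      sigmaMap R (q + 2) 1 ∘ₗ oneTensor (oneTensor φ) :=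
  TensorProduct.hom_ext_equiv (lconsTwo p) fun t x ↦ by
    simp only [LinearMap.comp_apply, sigmaMap_one_lconsTwo, oneTensor_oneTensor_lconsTwo]

lemma oneTensor_mul {n : ℕ} (f g : Module.End k (TP k V n)) :
    (oneTensor (f * g) : Module.End k (TP k V (n + 1))) = oneTensor f * oneTensor g :=
  oneTensor_comp f g

lemma tensorOne_mul {n : ℕ} (f g : Module.End k (TP k V n)) :
    (tensorOne (f * g) : Module.End k (TP k V (n + 1))) = tensorOne f * tensorOne g :=
  tensorOne_comp f g

/-- The relations of the braid monoid on `n + 1` strands, for a sequence of elements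
`s 1, …, s n` of a monoid. -/
structure BraidRelations {M : Type*} [Monoid M] (n : ℕ) (s : ℕ → M) : Prop where
  commute : ∀ i j, 1 ≤ i → i + 2 ≤ j → j ≤ n → Commute (s i) (s j)
  braid : ∀ i, 1 ≤ i → i + 1 ≤ n → s i * s (i + 1) * s i = s (i + 1) * s i * s (i + 1)

theorem braidRelations_sigmaMap (R : V ⊗[k] V →ₗ[k] V ⊗[k] V)
    (hYB : (sigmaMap R 2 1 * sigmaMap R 2 2 * sigmaMap R 2 1 : Module.End k (TP k V 2)) =
      sigmaMap R 2 2 * sigmaMap R 2 1 * sigmaMap R 2 2) (n : ℕ) :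
    BraidRelations (M := Module.End k (TP k V n)) n (sigmaMap R n) := by
  induction n with
  | zero => exact ⟨fun i j _ _ _ ↦ by lia, fun i _ _ ↦ by lia⟩
  | succ n ih =>
    refine ⟨fun i j hi hij hj ↦ ?_, fun i hi hin ↦ ?_⟩
    · obtain ⟨j, rfl⟩ : ∃ l, j = l + 1 := ⟨j - 1, by lia⟩
      obtain rfl | ⟨i, rfl, hi'⟩ : i = 1 ∨ ∃ l, i = l + 1 ∧ 1 ≤ l := by
        rcases hi.eq_or_lt with h | h
        · exact .inl h.symm
        · exact .inr ⟨i - 1, by lia, by lia⟩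
      · obtain ⟨j, rfl⟩ : ∃ l, j = l + 1 := ⟨j - 1, by lia⟩
        obtain ⟨n, rfl⟩ : ∃ l, n = l + 1 := ⟨n - 1, by lia⟩
        rw [← oneTensor_sigmaMap R (show 1 ≤ j + 1 by lia) (by lia),
          ← oneTensor_sigmaMap R (show 1 ≤ j by lia) (by lia)]
        exact (oneTensor_oneTensor_comp_sigmaMap_one R _).symm
      · rw [← oneTensor_sigmaMap R (by lia) (by lia),
          ← oneTensor_sigmaMap R (by lia) (by lia), Commute, SemiconjBy, ← oneTensor_mul,
          ← oneTensor_mul, (ih.commute i j hi' (by lia) (by lia)).eq]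
    · obtain rfl | ⟨i, rfl, hi'⟩ : i = 1 ∨ ∃ l, i = l + 1 ∧ 1 ≤ l := by
        rcases hi.eq_or_lt with h | h
        · exact .inl h.symm
        · exact .inr ⟨i - 1, by lia, by lia⟩
      · obtain rfl | hn : n = 1 ∨ 2 ≤ n := by lia
        · exact hYB
        · simp only [← tensorOne_sigmaMap R (show 1 ≤ n by lia),
            ← tensorOne_sigmaMap R (show 1 + 1 ≤ n by lia), ← tensorOne_mul,
            ih.braid 1 le_rfl (by lia)]
      · rw [← oneTensor_sigmaMap R (by lia) (by lia),
          ← oneTensor_sigmaMap R (by lia) (by lia)]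
        simp only [← oneTensor_mul, ih.braid i hi' (by lia)]

section Words

variable {M : Type*} [Monoid M] (s : ℕ → M)

/-- The increasing word `s i * s (i + 1) * ⋯ * s (i + l - 1)`. -/
def upWord (i l : ℕ) : M := ((List.range' i l).map s).prod

/-- The decreasing word `s (i + l - 1) * ⋯ * s (i + 1) * s i`. -/
def downWord (i l : ℕ) : M := ((List.range' i l).reverse.map s).prod

@[simp] lemma upWord_zero (i : ℕ) : upWord s i 0 = 1 := by simp [upWord]

@[simp] lemma downWord_zero (i : ℕ) : downWord s i 0 = 1 := by simp [downWord]

lemma upWord_add (i l m : ℕ) : upWord s i (l + m) = upWord s i l * upWord s (i + l) m := by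
  simp [upWord, ← List.range'_append_1]

lemma downWord_add (i l m : ℕ) :
    downWord s i (l + m) = downWord s (i + l) m * downWord s i l := by
  simp [downWord, ← List.range'_append_1]

@[simp] lemma upWord_one (i : ℕ) : upWord s i 1 = s i := by simp [upWord]

@[simp] lemma downWord_one (i : ℕ) : downWord s i 1 = s i := by simp [downWord]

lemma upWord_succ (i l : ℕ) : upWord s i (l + 1) = upWord s i l * s (i + l) := by
  simp [upWord_add]

lemma downWord_succ (i l : ℕ) : downWord s i (l + 1) = s (i + l) * downWord s i l := by
  simp [downWord_add]

lemma upWord_succ_left (i l : ℕ) : upWord s i (l + 1) = s i * upWord s (i + 1) l := by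
  rw [add_comm, upWord_add, upWord_one]

lemma downWord_succ_right (i l : ℕ) : downWord s i (l + 1) = downWord s (i + 1) l * s i := by
  rw [add_comm, downWord_add, downWord_one]

variable {s}

lemma SemiconjBy.upWord_right {x : M} {i j l : ℕ}
    (h : ∀ m < l, SemiconjBy x (s (i + m)) (s (j + m))) :
    SemiconjBy x (upWord s i l) (upWord s j l) := by
  induction l with
  | zero => simp
  | succ l ih =>
    simp only [upWord_succ]
    exact (ih fun m hm ↦ h m (by lia)).mul_right (h l (by lia))

lemma SemiconjBy.downWord_right {x : M} {i j l : ℕ}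
    (h : ∀ m < l, SemiconjBy x (s (i + m)) (s (j + m))) :
    SemiconjBy x (downWord s i l) (downWord s j l) := by
  induction l with
  | zero => simp
  | succ l ih =>
    simp only [downWord_succ]
    exact (h l (by lia)).mul_right (ih fun m hm ↦ h m (by lia))

namespace BraidRelations

variable {n : ℕ}

lemma commute_upWord_downWord (hs : BraidRelations n s) {i l j m : ℕ} (hi : 1 ≤ i)
    (hij : i + l + 1 ≤ j) (hj : j + m ≤ n + 1) : Commute (upWord s i l) (downWord s j m) :=
  SemiconjBy.downWord_right fun b hb ↦ (SemiconjBy.upWord_right fun c hc ↦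
    (hs.commute (i + c) (j + b) (by lia) (by lia) (by lia)).symm).symm

lemma commute_downWord_upWord (hs : BraidRelations n s) {i l j m : ℕ} (hi : 1 ≤ i)
    (hij : i + l + 1 ≤ j) (hj : j + m ≤ n + 1) : Commute (downWord s i l) (upWord s j m) :=
  SemiconjBy.upWord_right fun b hb ↦ (SemiconjBy.downWord_right fun c hc ↦
    (hs.commute (i + c) (j + b) (by lia) (by lia) (by lia)).symm).symm

lemma semiconjBy_upWord (hs : BraidRelations n s) {i l m : ℕ} (hi : 1 ≤ i) (him : i ≤ m)
    (hm : m + 1 < i + l) (hl : i + l ≤ n + 1) : SemiconjBy (upWord s i l) (s m) (s (m + 1)) := by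
  obtain ⟨d, rfl⟩ := Nat.exists_eq_add_of_le him
  obtain ⟨e, rfl⟩ : ∃ e, l = d + (2 + e) := ⟨l - d - 2, by lia⟩
  have h : upWord s (i + d) 2 = s (i + d) * s (i + d + 1) := by simp [upWord, List.range']
  rw [upWord_add, upWord_add, h]
  refine .mul_left (y := s (i + d + 1)) (Commute.symm (SemiconjBy.upWord_right fun b hb ↦ ?_))
    (.mul_left (y := s (i + d)) ?_ (SemiconjBy.upWord_right fun b hb ↦ ?_).symm)
  · exact (hs.commute _ _ (by lia) (by lia) (by lia)).symm
  · rw [SemiconjBy, hs.braid _ (by lia) (by lia), mul_assoc]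
  · exact hs.commute _ _ (by lia) (by lia) (by lia)

lemma semiconjBy_downWord (hs : BraidRelations n s) {i l m : ℕ} (hi : 1 ≤ i) (him : i ≤ m)
    (hm : m + 1 < i + l) (hl : i + l ≤ n + 1) :
    SemiconjBy (downWord s i l) (s (m + 1)) (s m) := by
  obtain ⟨d, rfl⟩ := Nat.exists_eq_add_of_le him
  obtain ⟨e, rfl⟩ : ∃ e, l = d + (2 + e) := ⟨l - d - 2, by lia⟩
  have h : downWord s (i + d) 2 = s (i + d + 1) * s (i + d) := by simp [downWord, List.range']
  rw [downWord_add, downWord_add, h]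
  refine .mul_left (y := s (i + d + 1)) (.mul_left (y := s (i + d))
    (Commute.symm (SemiconjBy.downWord_right fun b hb ↦ ?_)) ?_)
    (Commute.symm (SemiconjBy.downWord_right fun b hb ↦ ?_))
  · exact hs.commute _ _ (by lia) (by lia) (by lia)
  · rw [SemiconjBy, ← hs.braid _ (by lia) (by lia), mul_assoc]
  · exact (hs.commute _ _ (by lia) (by lia) (by lia)).symm

lemma upWord_mul_upWord (hs : BraidRelations n s) {i l j m : ℕ} (hi : 1 ≤ i) (hij : i ≤ j)
    (hm : j + m < i + l) (hl : i + l ≤ n + 1) :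
    upWord s i l * upWord s j m = upWord s (j + 1) m * upWord s i l :=
  SemiconjBy.upWord_right fun b hb ↦ by
    rw [Nat.add_right_comm]
    exact hs.semiconjBy_upWord hi (by lia) (by lia) hl

lemma upWord_mul_downWord (hs : BraidRelations n s) {i l j m : ℕ} (hi : 1 ≤ i) (hij : i ≤ j)
    (hm : j + m < i + l) (hl : i + l ≤ n + 1) :
    upWord s i l * downWord s j m = downWord s (j + 1) m * upWord s i l :=
  SemiconjBy.downWord_right fun b hb ↦ by
    rw [Nat.add_right_comm]
    exact hs.semiconjBy_upWord hi (by lia) (by lia) hl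

lemma downWord_mul_upWord (hs : BraidRelations n s) {i l j m : ℕ} (hi : 1 ≤ i) (hij : i ≤ j)
    (hm : j + m < i + l) (hl : i + l ≤ n + 1) :
    downWord s i l * upWord s (j + 1) m = upWord s j m * downWord s i l :=
  SemiconjBy.upWord_right fun b hb ↦ by
    rw [Nat.add_right_comm]
    exact hs.semiconjBy_downWord hi (by lia) (by lia) hl

lemma downWord_mul_downWord (hs : BraidRelations n s) {i l j m : ℕ} (hi : 1 ≤ i) (hij : i ≤ j)
    (hm : j + m < i + l) (hl : i + l ≤ n + 1) :
    downWord s i l * downWord s (j + 1) m = downWord s j m * downWord s i l :=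
  SemiconjBy.downWord_right fun b hb ↦ by
    rw [Nat.add_right_comm]
    exact hs.semiconjBy_downWord hi (by lia) (by lia) hl

/-- A decreasing word ending at `s 1` passes an increasing word starting inside it. -/
lemma downWord_mul_upWord_overlap (hs : BraidRelations n s) {i j c : ℕ} (hij : i ≤ j)
    (hc : i + 1 + c ≤ n) (hj : j ≤ i + c) :
    downWord s 1 (j + 1) * upWord s (i + 2) c = upWord s (i + 1) (c + 1) * downWord s 1 j := by
  obtain ⟨d, rfl⟩ := Nat.exists_eq_add_of_le hij
  obtain ⟨e, rfl⟩ : ∃ e, c = d + e := ⟨c - d, by lia⟩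
  have hcomm := (hs.commute_downWord_upWord (i := 1) (l := i + d) (j := i + 2 + d) (m := e)
    le_rfl (by lia) (by lia)).eq
  rw [upWord_add, ← mul_assoc, hs.downWord_mul_upWord le_rfl (by lia) (by lia) (by lia),
    downWord_succ, mul_assoc, mul_assoc, hcomm, add_assoc d, upWord_add, upWord_succ_left,
    show 1 + (i + d) = i + 1 + d by lia, show i + 2 + d = i + 1 + d + 1 by lia]
  simp only [mul_assoc]

/-- An increasing word starting at `s 1` passes a decreasing word ending inside it. -/
lemma upWord_mul_downWord_overlap (hs : BraidRelations n s) {p q c : ℕ} (hqp : q ≤ p)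
    (hc : q + 1 + c ≤ n) (hp : p ≤ q + c) :
    upWord s 1 p * downWord s (q + 1) (c + 1) = downWord s (q + 2) c * upWord s 1 (p + 1) := by
  obtain ⟨d, rfl⟩ := Nat.exists_eq_add_of_le hqp
  obtain ⟨e, rfl⟩ : ∃ e, c = d + e := ⟨c - d, by lia⟩
  have hcomm := (hs.commute_upWord_downWord (i := 1) (l := q + d) (j := q + 2 + d) (m := e)
    le_rfl (by lia) (by lia)).eq
  rw [downWord_add s (q + 2), mul_assoc, ← hs.upWord_mul_downWord le_rfl (by lia) (by lia)
    (by lia), ← mul_assoc, upWord_succ, ← mul_assoc, ← hcomm, add_assoc d, downWord_add,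
    downWord_succ_right, show 1 + (q + d) = q + 1 + d by lia,
    show q + 2 + d = q + 1 + d + 1 by lia]
  simp only [mul_assoc]

end BraidRelations

end Words

/-- The increasing word in the `σ_{n+1,i}`. -/
abbrev sigmaUp (R : V ⊗[k] V →ₗ[k] V ⊗[k] V) (n i l : ℕ) : Module.End k (TP k V n) :=
  upWord (M := Module.End k (TP k V n)) (sigmaMap R n) i l

/-- The decreasing word in the `σ_{n+1,i}`. -/
abbrev sigmaDown (R : V ⊗[k] V →ₗ[k] V ⊗[k] V) (n i l : ℕ) : Module.End k (TP k V n) :=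
  downWord (M := Module.End k (TP k V n)) (sigmaMap R n) i l

lemma sigmaComp_eq_prod (R : V ⊗[k] V →ₗ[k] V ⊗[k] V) (n : ℕ) (l : List ℕ) :
    sigmaComp R n l =
      (l.map (sigmaMap R n : ℕ → Module.End k (TP k V n))).prod := by
  induction l with
  | nil => rfl
  | cons i l ih =>
    rw [List.map_cons, List.prod_cons, ← ih]
    rfl

lemma oneTensor_sigmaUp (R : V ⊗[k] V →ₗ[k] V ⊗[k] V) {n i l : ℕ} (hi : 1 ≤ i)
    (hl : i + l ≤ n + 1) : oneTensor (sigmaUp R n i l) = sigmaUp R (n + 1) (i + 1) l := by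
  induction l with
  | zero =>
    simp only [sigmaUp, upWord_zero]
    exact oneTensor_id n
  | succ l ih =>
    simp only [sigmaUp] at ih ⊢
    rw [upWord_succ, upWord_succ, oneTensor_mul, ih (by lia),
      oneTensor_sigmaMap R (by lia) (by lia), Nat.add_right_comm]

lemma oneTensor_sigmaDown (R : V ⊗[k] V →ₗ[k] V ⊗[k] V) {n i l : ℕ} (hi : 1 ≤ i)
    (hl : i + l ≤ n + 1) : oneTensor (sigmaDown R n i l) = sigmaDown R (n + 1) (i + 1) l := by
  induction l with
  | zero =>
    simp only [sigmaDown, downWord_zero]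
    exact oneTensor_id n
  | succ l ih =>
    simp only [sigmaDown] at ih ⊢
    rw [downWord_succ, downWord_succ, oneTensor_mul, ih (by lia),
      oneTensor_sigmaMap R (by lia) (by lia), Nat.add_right_comm]

lemma tensorOne_sigmaUp (R : V ⊗[k] V →ₗ[k] V ⊗[k] V) {n i l : ℕ} (hl : i + l ≤ n + 1) :
    tensorOne (sigmaUp R n i l) = sigmaUp R (n + 1) i l := by
  induction l with
  | zero =>
    simp only [sigmaUp, upWord_zero]
    exact tensorOne_id n
  | succ l ih =>
    simp only [sigmaUp] at ih ⊢
    rw [upWord_succ, upWord_succ, tensorOne_mul, ih (by lia), tensorOne_sigmaMap R (by lia)]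

lemma tensorOne_sigmaDown (R : V ⊗[k] V →ₗ[k] V ⊗[k] V) {n i l : ℕ} (hl : i + l ≤ n + 1) :
    tensorOne (sigmaDown R n i l) = sigmaDown R (n + 1) i l := by
  induction l with
  | zero =>
    simp only [sigmaDown, downWord_zero]
    exact tensorOne_id n
  | succ l ih =>
    simp only [sigmaDown] at ih ⊢
    rw [downWord_succ, downWord_succ, tensorOne_mul, ih (by lia), tensorOne_sigmaMap R (by lia)]

/-- A strand ending at output position `j + 1` and passing to the left of `φ`. -/
def leftFace (R : V ⊗[k] V →ₗ[k] V ⊗[k] V) {a b : ℕ} (j : ℕ) (φ : TP k V a →ₗ[k] TP k V b) :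
    TP k V (a + 1) →ₗ[k] TP k V (b + 1) :=
  sigmaDown R (b + 1) 1 j ∘ₗ oneTensor φ ∘ₗ sigmaUp R (a + 1) 1 (a + 1 - j)

/-- A strand ending at output position `j + 1` and passing to the right of `φ`. -/
def rightFace (R : V ⊗[k] V →ₗ[k] V ⊗[k] V) {a b : ℕ} (j : ℕ) (φ : TP k V a →ₗ[k] TP k V b) :
    TP k V (a + 1) →ₗ[k] TP k V (b + 1) :=
  sigmaUp R (b + 1) (j + 1) (b + 1 - j) ∘ₗ tensorOne φ ∘ₗ sigmaDown R (a + 1) (a + 1 - j + 1) j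

/-- Nested two-sided compositions as a two-sided composition with products. -/
lemma comp_comp_comp_eq_mul {A B : Type*} [AddCommGroup A] [Module k A] [AddCommGroup B]
    [Module k B] (F : A →ₗ[k] B) (X Y : Module.End k B) (Z W : Module.End k A) :
    X ∘ₗ (Y ∘ₗ F ∘ₗ Z) ∘ₗ W = (X * Y) ∘ₗ F ∘ₗ (Z * W) :=
  rfl

lemma mul_comp_eq_comp_mul {A B : Type*} [AddCommGroup A] [Module k A] [AddCommGroup B]
    [Module k B] {F : A →ₗ[k] B} {s : Module.End k A} {t : Module.End k B}
    (h : F ∘ₗ s = t ∘ₗ F) (X : Module.End k B) (W : Module.End k A) :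
    (X * t) ∘ₗ F ∘ₗ W = X ∘ₗ F ∘ₗ (s * W) := by
  change X ∘ₗ (t ∘ₗ F) ∘ₗ W = X ∘ₗ (F ∘ₗ s) ∘ₗ W
  rw [h]

section Cubical

variable {R : V ⊗[k] V →ₗ[k] V ⊗[k] V} {a b i j : ℕ}

lemma leftFace_leftFace
    (hR : ∀ n, BraidRelations (M := Module.End k (TP k V n)) n (sigmaMap R n))
    (φ : TP k V a →ₗ[k] TP k V b) (hij : i ≤ j) (hjb : j ≤ b) (hba : b ≤ a) :
    leftFace R (j + 1) (leftFace R i φ) = leftFace R i (leftFace R j φ) := by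
  simp only [leftFace, oneTensor_comp]
  rw [oneTensor_sigmaUp R (by lia) (by lia), oneTensor_sigmaDown R (by lia) (by lia),
    oneTensor_sigmaUp R (by lia) (by lia), oneTensor_sigmaDown R (by lia) (by lia),
    comp_comp_comp_eq_mul, comp_comp_comp_eq_mul, Nat.add_sub_add_right,
    show a + 1 + 1 - i = a + 1 - i + 1 by lia,
    ← (hR _).upWord_mul_upWord (i := 1) (l := a + 1 - i + 1) (j := 1) (m := a + 1 - j)
      le_rfl le_rfl (by lia) (by lia),
    (hR _).downWord_mul_downWord (i := 1) (l := j + 1) (j := 1) (m := i)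
      le_rfl le_rfl (by lia) (by lia),
    downWord_succ_right _ 1 j, upWord_succ_left _ 1 (a + 1 - i), ← mul_assoc,
    mul_comp_eq_comp_mul (oneTensor_oneTensor_comp_sigmaMap_one R φ), mul_assoc]

lemma rightFace_rightFace
    (hR : ∀ n, BraidRelations (M := Module.End k (TP k V n)) n (sigmaMap R n))
    (φ : TP k V a →ₗ[k] TP k V b) (hij : i ≤ j) (hjb : j ≤ b) (hba : b ≤ a) :
    rightFace R (j + 1) (rightFace R i φ) = rightFace R i (rightFace R j φ) := by
  have hdown : downWord (M := Module.End k (TP k V (a + 1 + 1))) (sigmaMap R (a + 1 + 1))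
      (a + 1 - j + 1) (j + 1) = sigmaMap R (a + 1 + 1) (a + 1 + 1) *
        downWord (sigmaMap R (a + 1 + 1)) (a + 1 - j + 1) j := by
    rw [downWord_succ, show a + 1 - j + 1 + j = a + 1 + 1 by lia]
  have hup : upWord (M := Module.End k (TP k V (b + 1 + 1))) (sigmaMap R (b + 1 + 1))
      (i + 1) (b + 1 - i + 1) = upWord (sigmaMap R (b + 1 + 1)) (i + 1) (b + 1 - i) *
        sigmaMap R (b + 1 + 1) (b + 1 + 1) := by
    rw [upWord_succ, show i + 1 + (b + 1 - i) = b + 1 + 1 by lia]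
  simp only [rightFace, tensorOne_comp]
  rw [tensorOne_sigmaUp R (by lia), tensorOne_sigmaDown R (by lia), tensorOne_sigmaUp R (by lia),
    tensorOne_sigmaDown R (by lia), comp_comp_comp_eq_mul, comp_comp_comp_eq_mul,
    Nat.add_sub_add_right, Nat.add_sub_add_right,
    show a + 1 + 1 - i = a + 1 - i + 1 by lia, show b + 1 + 1 - i = b + 1 - i + 1 by lia,
    (hR _).upWord_mul_upWord (i := i + 1) (l := b + 1 - i + 1) (j := j + 1) (m := b + 1 - j)
      (by lia) (by lia) (by lia) (by lia), hup, ← mul_assoc,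
    mul_comp_eq_comp_mul (tensorOne_tensorOne_comp_sigmaMap_top R φ), ← mul_assoc, ← hdown,
    (hR _).downWord_mul_downWord (i := a + 1 - j + 1) (l := j + 1) (j := a + 1 - i + 1) (m := i)
      (by lia) (by lia) (by lia) (by lia)]

lemma leftFace_rightFace
    (hR : ∀ n, BraidRelations (M := Module.End k (TP k V n)) n (sigmaMap R n))
    (φ : TP k V a →ₗ[k] TP k V b) (hij : i ≤ j) (hjb : j ≤ b) (hba : b ≤ a) :
    leftFace R (j + 1) (rightFace R i φ) = rightFace R i (leftFace R j φ) := by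
  simp only [leftFace, rightFace, oneTensor_comp, tensorOne_comp]
  rw [oneTensor_sigmaUp R (by lia) (by lia), oneTensor_sigmaDown R (by lia) (by lia),
    tensorOne_sigmaUp R (by lia), tensorOne_sigmaDown R (by lia),
    comp_comp_comp_eq_mul, comp_comp_comp_eq_mul, Nat.add_sub_add_right,
    show a + 1 + 1 - i = a + 1 - i + 1 by lia, show b + 1 + 1 - i = b + 1 - i + 1 by lia,
    (hR _).downWord_mul_upWord_overlap hij (by lia) (by lia), oneTensor_tensorOne,
    ((hR _).commute_upWord_downWord le_rfl (by lia) (by lia)).eq]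

lemma rightFace_leftFace
    (hR : ∀ n, BraidRelations (M := Module.End k (TP k V n)) n (sigmaMap R n))
    (φ : TP k V a →ₗ[k] TP k V b) (hij : i ≤ j) (hjb : j ≤ b) (hba : b ≤ a) :
    rightFace R (j + 1) (leftFace R i φ) = leftFace R i (rightFace R j φ) := by
  simp only [leftFace, rightFace, oneTensor_comp, tensorOne_comp]
  rw [oneTensor_sigmaUp R (by lia) (by lia), oneTensor_sigmaDown R (by lia) (by lia),
    tensorOne_sigmaUp R (by lia), tensorOne_sigmaDown R (by lia),
    comp_comp_comp_eq_mul, comp_comp_comp_eq_mul, Nat.add_sub_add_right, Nat.add_sub_add_right,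
    show a + 1 + 1 - i = a + 1 - i + 1 by lia,
    (hR _).upWord_mul_downWord_overlap (by lia) (by lia) (by lia), oneTensor_tensorOne,
    ((hR _).commute_downWord_upWord le_rfl (by lia) (by lia)).eq]

end Cubical

/-- The signed face `leftFace - rightFace`, additively in `φ`. -/
def faceDiff (R : V ⊗[k] V →ₗ[k] V ⊗[k] V) (a b j : ℕ) :
    (TP k V a →ₗ[k] TP k V b) →+ (TP k V (a + 1) →ₗ[k] TP k V (b + 1)) :=
  AddMonoidHom.mk' (fun φ ↦ leftFace R j φ - rightFace R j φ) fun φ ψ ↦ by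
    simp only [leftFace, rightFace, oneTensor_add, tensorOne_add, LinearMap.add_comp,
      LinearMap.comp_add]
    abel

lemma faceDiff_apply (R : V ⊗[k] V →ₗ[k] V ⊗[k] V) (a b j : ℕ) (φ : TP k V a →ₗ[k] TP k V b) :
    faceDiff R a b j φ = leftFace R j φ - rightFace R j φ :=
  rfl

lemma d2M_eq_sum_faceDiff (R : V ⊗[k] V →ₗ[k] V ⊗[k] V) (a b : ℕ)
    (φ : TP k V a →ₗ[k] TP k V b) :
    d2M R a b φ = ∑ j ∈ Finset.range (b + 1), ((-1 : ℤ) ^ (a + j)) • faceDiff R a b j φ := by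
  simp only [d2M, sigmaComp_eq_prod,
    show ∀ c j : ℕ, c + 2 - (j + 1) = c + 1 - j by lia]
  rfl

lemma faceDiff_faceDiff {R : V ⊗[k] V →ₗ[k] V ⊗[k] V}
    (hR : ∀ n, BraidRelations (M := Module.End k (TP k V n)) n (sigmaMap R n)) {a b i j : ℕ}
    (φ : TP k V a →ₗ[k] TP k V b) (hij : i ≤ j) (hjb : j ≤ b) (hba : b ≤ a) :
    faceDiff R (a + 1) (b + 1) (j + 1) (faceDiff R a b i φ) =
      faceDiff R (a + 1) (b + 1) i (faceDiff R a b j φ) := by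
  rw [faceDiff_apply R a b i, faceDiff_apply R a b j, map_sub, map_sub]
  simp only [faceDiff_apply]
  rw [leftFace_leftFace hR φ hij hjb hba, rightFace_rightFace hR φ hij hjb hba,
    leftFace_rightFace hR φ hij hjb hba, rightFace_leftFace hR φ hij hjb hba]
  abel

/-- The alternating double sum of a family satisfying the cubical identities vanishes. -/
lemma sum_sum_neg_one_pow_eq_zero {A : Type*} [AddCommGroup A] (b : ℕ) (f : ℕ → ℕ → A)
    (h : ∀ i j, i ≤ j → j ≤ b → f (j + 1) i = f i j) :
    ∑ j ∈ Finset.range (b + 2), ∑ i ∈ Finset.range (b + 1), ((-1 : ℤ) ^ (j + i)) • f j i = 0 := by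
  rw [← Finset.sum_product']
  refine Finset.sum_involution
    (fun p _ ↦ if p.2 < p.1 then (p.2, p.1 - 1) else (p.2 + 1, p.1)) ?_ ?_ ?_ ?_
  · rintro ⟨j, i⟩ hp
    simp only [Finset.mem_product, Finset.mem_range] at hp
    dsimp only
    split_ifs with hij
    · obtain ⟨j, rfl⟩ : ∃ l, j = l + 1 := ⟨j - 1, by lia⟩
      rw [h i j (by lia) (by lia), Nat.add_sub_cancel, ← add_smul,
        show j + 1 + i = i + j + 1 by lia, pow_succ]
      simp
    · rw [h j i (by lia) (by lia), ← add_smul, show i + 1 + j = j + i + 1 by lia, pow_succ]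
      simp
  · rintro ⟨j, i⟩ hp _
    dsimp only
    split_ifs <;> simp only [ne_eq, Prod.mk.injEq] <;> lia
  · rintro ⟨j, i⟩ hp
    simp only [Finset.mem_product, Finset.mem_range] at hp ⊢
    split_ifs <;> lia
  · rintro ⟨j, i⟩ hp
    dsimp only
    split_ifs <;> simp only [Prod.mk.injEq] at * <;> lia

/-- for a solution `R` of the Yang-Baxter equation, the
multicomplex differential `d₂` squares to zero: for every
`φ : V^{⊗n} → V^{⊗q}` with `n > q ≥ 2` one has `d₂(d₂(φ)) = 0`.
Here `n = a + 1` and `q = b + 1`, so the hypothesis reads `a > b ≥ 1`. -/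
theorem d2M_d2M_eq_zero (R : V ⊗[k] V →ₗ[k] V ⊗[k] V)
    (hYB : R.rTensor V ∘ₗ ((TensorProduct.assoc k V V V).symm.toLinearMap ∘ₗ
        R.lTensor V ∘ₗ (TensorProduct.assoc k V V V).toLinearMap) ∘ₗ R.rTensor V =
      ((TensorProduct.assoc k V V V).symm.toLinearMap ∘ₗ R.lTensor V ∘ₗ
        (TensorProduct.assoc k V V V).toLinearMap) ∘ₗ R.rTensor V ∘ₗ
        ((TensorProduct.assoc k V V V).symm.toLinearMap ∘ₗ R.lTensor V ∘ₗ
          (TensorProduct.assoc k V V V).toLinearMap))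
    (a b : ℕ) (hb : 1 ≤ b) (hab : b < a) (φ : TP k V a →ₗ[k] TP k V b) :
    d2M R (a + 1) (b + 1) (d2M R a b φ) = 0 := by
  have hR := braidRelations_sigmaMap R hYB
  rw [d2M_eq_sum_faceDiff, d2M_eq_sum_faceDiff]
  simp only [map_sum, map_zsmul, Finset.smul_sum, smul_smul]
  rw [← sum_sum_neg_one_pow_eq_zero b
    (fun j i ↦ (-1 : ℤ) • faceDiff R (a + 1) (b + 1) j (faceDiff R a b i φ))
    fun i j hij hjb ↦ by rw [faceDiff_faceDiff hR φ hij hjb hab.le]]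
  refine Finset.sum_congr rfl fun j _ ↦ Finset.sum_congr rfl fun i _ ↦ ?_
  rw [smul_smul]
  congr 1
  rw [← pow_add, ← pow_succ, show a + 1 + j + (a + i) = j + i + 1 + 2 * a by lia,
    pow_add _ _ (2 * a), pow_mul]
  simp

end
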